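/- Let K = GF(2), let A = [[0,1],[1,1]] ∈ GL(2,K), let I be the 2×2 identity, and let G ≤ GL(6,K) be the subgroup generated by the two 6×6 block matrices [[0,A,0],[0,0,I],[I,0,0]] and [[0,I,0],[0,0,A],[I,0,0]]. Let Q be the quadratic form on K⁶ given by Q(y) = y₁² + y₁y₂ + y₂² + y₃² + y₃y₄ + y₄² + y₅² + y₅y₆ + y₆². Then G is an extraspecial group of order 27 and exponent 9, every element of G preserves Q, and G acts freely and transitively on the 27 nonzero vectors v ∈ K⁶ with Q(v) = 0 (i.e. G acts regularly on the points of the elliptic quadric Q⁻(5,2)). -/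

import Mathlib

open Matrix

/-- The elliptic quadratic form `Q(y) = y₁² + y₁y₂ + y₂² + y₃² + y₃y₄ + y₄² + y₅² + y₅y₆ + y₆²`
on `GF(2)⁶`. -/
def Qform (y : Fin 6 → ZMod 2) : ZMod 2 :=
  y 0 ^ 2 + y 0 * y 1 + y 1 ^ 2 + y 2 ^ 2 + y 2 * y 3 + y 3 ^ 2 +
    y 4 ^ 2 + y 4 * y 5 + y 5 ^ 2

/-- The block matrix `[[0,A,0],[0,0,I],[I,0,0]]`, where `A = [[0,1],[1,1]]`. -/
def N1 : GL (Fin 6) (ZMod 2) :=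
  ⟨!![0,0,0,1,0,0; 0,0,1,1,0,0; 0,0,0,0,1,0; 0,0,0,0,0,1; 1,0,0,0,0,0; 0,1,0,0,0,0],
   !![0,0,0,0,1,0; 0,0,0,0,0,1; 1,1,0,0,0,0; 1,0,0,0,0,0; 0,0,1,0,0,0; 0,0,0,1,0,0],
   by decide, by decide⟩

/-- The block matrix `[[0,I,0],[0,0,A],[I,0,0]]`. -/
def N2 : GL (Fin 6) (ZMod 2) :=
  ⟨!![0,0,1,0,0,0; 0,0,0,1,0,0; 0,0,0,0,0,1; 0,0,0,0,1,1; 1,0,0,0,0,0; 0,1,0,0,0,0],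
   !![0,0,0,0,1,0; 0,0,0,0,0,1; 1,0,0,0,0,0; 0,1,0,0,0,0; 0,0,1,1,0,0; 0,0,1,0,0,0],
   by decide, by decide⟩

/-- The group `G = ⟨[[0,A,0],[0,0,I],[I,0,0]], [[0,I,0],[0,0,A],[I,0,0]]⟩ ≤ GL(6, GF(2))`. -/
def Gsub : Subgroup (GL (Fin 6) (ZMod 2)) := Subgroup.closure {N1, N2}

namespace Subgroup

variable {p : ℕ} [Fact p.Prime] {G : Type*} [Group G]

/-- A subgroup of prime index is maximal. -/
theorem isCoatom_of_index_prime {H : Subgroup G} (h : H.index.Prime) : IsCoatom H := by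
  refine ⟨fun hH => h.ne_one (index_eq_one.2 hH), fun K hK => ?_⟩
  have hmul := relIndex_mul_index hK.le
  rcases h.eq_one_or_self_of_dvd K.index ⟨_, by rw [mul_comm, hmul]⟩ with h1 | h1
  · exact index_eq_one.1 h1
  · rw [h1] at hmul
    have : H.relIndex K = 1 := Nat.eq_of_mul_eq_mul_right h.pos (by rw [hmul, one_mul])
    exact absurd (relIndex_eq_one.1 this) hK.not_ge

/-- The center of a nonabelian group of order `p ^ 3` has order `p`. -/
theorem card_center_of_card_eq_prime_cube (hG : Nat.card G = p ^ 3)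
    (hc : ¬ IsMulCommutative G) : Nat.card (center G) = p := by
  have hp : p.Prime := Fact.out
  obtain ⟨k, hk0, hk⟩ := IsPGroup.card_center_eq_prime_pow hG three_pos
  have hmul := (center G).card_mul_index
  rw [hk, hG] at hmul
  have hk3 : k ≤ 3 := (Nat.pow_dvd_pow_iff_le_right hp.one_lt).1 ⟨_, hmul.symm⟩
  by_contra hne
  have hk1 : k ≠ 1 := by rintro rfl; exact hne (by simpa using hk)
  have hdvd : Nat.card (G ⧸ center G) ∣ p := by
    refine Nat.dvd_of_mul_dvd_mul_left (pow_pos hp.pos 2) ?_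
    change p ^ 2 * (center G).index ∣ p ^ 2 * p
    rw [← pow_succ, ← hmul]
    exact mul_dvd_mul_right (pow_dvd_pow p (by omega)) _
  have := isCyclic_of_card_dvd_prime hdvd
  exact hc (isMulCommutative_of_isCyclic_quotient_center_self G)

/-- In a nonabelian group of order `p ^ 3` the derived subgroup is the center. -/
theorem commutator_eq_center_of_card_eq_prime_cube (hG : Nat.card G = p ^ 3)
    (hc : ¬ IsMulCommutative G) : _root_.commutator G = center G := by
  have hp : p.Prime := Fact.out
  have hZ := card_center_of_card_eq_prime_cube hG hc
  have hmul := (center G).card_mul_index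
  rw [hZ, hG] at hmul
  have hq : Nat.card (G ⧸ center G) = p ^ 2 :=
    Nat.eq_of_mul_eq_mul_left hp.pos (hmul.trans (by ring))
  have hle : _root_.commutator G ≤ center G :=
    Normal.quotient_commutative_iff_commutator_le.1
      (IsPGroup.isMulCommutative_of_card_eq_prime_sq hq)
  have : Finite (center G) := Nat.finite_of_card_ne_zero (hZ ▸ hp.ne_zero)
  refine eq_of_le_of_card_ge hle ?_
  rcases (Nat.dvd_prime hp).1 (hZ ▸ card_dvd_of_le hle) with h | h
  · refine absurd ?_ hc
    rw [card_eq_one] at h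
    have hcen := (commutator_eq_bot_iff_center_eq_top G).1 h
    exact ⟨⟨fun a b => (mem_center_iff.1 (hcen ▸ mem_top b) a)⟩⟩
  · rw [h, hZ]

/-- A central derived subgroup is contained in the Frattini subgroup. -/
theorem commutator_le_frattini_of_le_center (h : _root_.commutator G ≤ center G) :
    _root_.commutator G ≤ frattini G := by
  refine le_iInf₂ fun M hM => ?_
  by_contra hle
  have htop : M ⊔ center G = ⊤ :=
    hM.2 _ (left_lt_sup.2 fun hZ => hle (h.trans hZ))
  refine hle ?_
  rw [_root_.commutator_def, commutator_le]
  intro a _ b _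
  obtain ⟨m, hm, z, hz, rfl⟩ := mem_sup_of_normal_right.1 (htop ▸ mem_top a)
  obtain ⟨n, hn, w, hw, rfl⟩ := mem_sup_of_normal_right.1 (htop ▸ mem_top b)
  have hz' := mem_center_iff.1 hz
  have hw' := mem_center_iff.1 hw
  have : m * z * (n * w) * (m * z)⁻¹ * (n * w)⁻¹ = m * n * m⁻¹ * n⁻¹ := by
    rw [_root_.mul_inv_rev, _root_.mul_inv_rev]
    calc m * z * (n * w) * (z⁻¹ * m⁻¹) * (w⁻¹ * n⁻¹)
        = m * (z * n) * (w * z⁻¹) * m⁻¹ * w⁻¹ * n⁻¹ := by group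
      _ = m * n * (z * z⁻¹) * (w * m⁻¹) * w⁻¹ * n⁻¹ := by
        rw [← hz' n, ← hw' z⁻¹]; group
      _ = m * n * m⁻¹ * n⁻¹ := by rw [← hw' m⁻¹]; group
  rw [commutatorElement_def, this]
  exact M.mul_mem (M.mul_mem (M.mul_mem hm hn) (M.inv_mem hm)) (M.inv_mem hn)

/-- In a nonabelian group of order `p ^ 3` the Frattini subgroup is the center. -/
theorem frattini_eq_center_of_card_eq_prime_cube (hG : Nat.card G = p ^ 3)
    (hc : ¬ IsMulCommutative G) : frattini G = center G := by
  have hp : p.Prime := Fact.out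
  have : Finite G := Nat.finite_of_card_ne_zero (hG ▸ pow_ne_zero 3 hp.ne_zero)
  have hZ := card_center_of_card_eq_prime_cube hG hc
  have hcomm := commutator_eq_center_of_card_eq_prime_cube hG hc
  refine le_antisymm (fun g hg => ?_)
    (hcomm ▸ commutator_le_frattini_of_le_center hcomm.le)
  rw [mem_center_iff]
  intro h
  by_contra hgh
  -- The centralizer of `h` is a maximal subgroup.
  have hmem : ∀ x, x ∈ centralizer {h} ↔ h * x = x * h := fun x => by
    rw [mem_centralizer_singleton_iff, eq_comm]
  have hlt : center G < centralizer {h} := by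
    refine lt_of_le_of_ne (center_le_centralizer _) fun heq => hgh ?_
    exact (mem_center_iff.1 (heq ▸ (hmem h).2 rfl : h ∈ center G) g).symm
  have hmul := (centralizer {h}).card_mul_index
  rw [hG] at hmul
  obtain ⟨k, hk3, hk⟩ := (Nat.dvd_prime_pow hp).1 ⟨_, hmul.symm⟩
  have hk1 : 1 < k := by
    by_contra hk1
    refine hlt.ne (eq_of_le_of_card_ge hlt.le ?_)
    rw [hk, hZ]
    exact (Nat.pow_le_pow_right hp.pos (not_lt.1 hk1)).trans_eq (pow_one p)
  have hk2 : k ≠ 3 := by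
    rintro rfl
    have htop := eq_top_of_card_eq _ (hk.trans hG.symm)
    exact hgh ((hmem g).1 (htop ▸ mem_top g))
  obtain rfl : k = 2 := by omega
  have hidx : (centralizer {h}).index = p := by
    rw [hk] at hmul
    exact Nat.eq_of_mul_eq_mul_left (pow_pos hp.pos 2) (hmul.trans (by ring))
  have hco : IsCoatom (centralizer {h}) := isCoatom_of_index_prime (hidx ▸ hp)
  exact hgh ((hmem g).1 (frattini_le_coatom hco hg))

end Subgroup

/-- The block diagonal matrix `diag(A, A⁻¹, I)`. -/
def diagElt : GL (Fin 6) (ZMod 2) := N1 * N2⁻¹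

/-- The elements `N2 ^ i * diagElt ^ j` represent all elements of `Gsub`. -/
def normalWord (i : Fin 9) (j : Fin 3) : GL (Fin 6) (ZMod 2) :=
  N2 ^ (i : ℕ) * diagElt ^ (j : ℕ)

/-- A singular vector used as a base point. -/
def basePoint : Fin 6 → ZMod 2 := ![1, 0, 1, 0, 0, 0]

theorem N1_mem_Gsub : N1 ∈ Gsub := Subgroup.subset_closure (by simp)

theorem N2_mem_Gsub : N2 ∈ Gsub := Subgroup.subset_closure (by simp)

theorem diagElt_mem_Gsub : diagElt ∈ Gsub :=
  Gsub.mul_mem N1_mem_Gsub (Gsub.inv_mem N2_mem_Gsub)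

theorem normalWord_mem_Gsub (i : Fin 9) (j : Fin 3) : normalWord i j ∈ Gsub :=
  Gsub.mul_mem (Gsub.pow_mem N2_mem_Gsub _) (Gsub.pow_mem diagElt_mem_Gsub _)

set_option maxRecDepth 10000 in
theorem N2_pow_nine : N2 ^ 9 = 1 := by decide +kernel

set_option maxRecDepth 10000 in
theorem diagElt_pow_three : diagElt ^ 3 = 1 := by decide +kernel

set_option maxRecDepth 10000 in
theorem diagElt_mul_N2 : diagElt * N2 = N2 ^ 7 * diagElt := by decide +kernel

theorem diagElt_pow_mul_N2_pow (j k : ℕ) :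
    diagElt ^ j * N2 ^ k = N2 ^ (7 ^ j * k) * diagElt ^ j := by
  have h1 : ∀ k : ℕ, diagElt * N2 ^ k = N2 ^ (7 * k) * diagElt := fun k => by
    have : SemiconjBy diagElt N2 (N2 ^ 7) := diagElt_mul_N2
    simpa only [pow_mul] using (this.pow_right k).eq
  induction j generalizing k with
  | zero => simp
  | succ j ih => rw [pow_succ, mul_assoc, h1, ← mul_assoc, ih, mul_assoc, pow_succ, mul_assoc]

theorem exists_pow_mul_pow_of_mem_Gsub {g : GL (Fin 6) (ZMod 2)} (hg : g ∈ Gsub) :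
    ∃ i j : ℕ, g = N2 ^ i * diagElt ^ j := by
  have hmul : ∀ i j k l : ℕ, (N2 ^ i * diagElt ^ j) * (N2 ^ k * diagElt ^ l) =
      N2 ^ (i + 7 ^ j * k) * diagElt ^ (j + l) := fun i j k l => by
    rw [pow_add, pow_add, mul_assoc, ← mul_assoc (diagElt ^ j), diagElt_pow_mul_N2_pow]
    simp only [mul_assoc]
  induction hg using Subgroup.closure_induction with
  | mem x hx =>
    rcases hx with rfl | rfl
    · refine ⟨7, 1, ?_⟩
      rw [pow_one, ← diagElt_mul_N2, diagElt, inv_mul_cancel_right]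
    · exact ⟨1, 0, by simp⟩
  | one => exact ⟨0, 0, by simp⟩
  | mul x y _ _ hx hy =>
    obtain ⟨i, j, rfl⟩ := hx
    obtain ⟨k, l, rfl⟩ := hy
    exact ⟨_, _, hmul i j k l⟩
  | inv x _ hx =>
    obtain ⟨i, j, rfl⟩ := hx
    refine ⟨7 ^ (2 * j) * (8 * i), 2 * j, ?_⟩
    rw [← diagElt_pow_mul_N2_pow, inv_eq_iff_mul_eq_one, mul_assoc, ← mul_assoc (diagElt ^ j),
      ← pow_add, show j + 2 * j = 3 * j by ring, pow_mul, diagElt_pow_three, one_pow, one_mul,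
      ← pow_add, show i + 8 * i = 9 * i by ring, pow_mul, N2_pow_nine, one_pow]

theorem mem_Gsub_iff {g : GL (Fin 6) (ZMod 2)} :
    g ∈ Gsub ↔ ∃ i j, g = normalWord i j := by
  constructor
  · intro hg
    obtain ⟨i, j, rfl⟩ := exists_pow_mul_pow_of_mem_Gsub hg
    refine ⟨Fin.ofNat 9 i, Fin.ofNat 3 j, ?_⟩
    simp only [normalWord, Fin.val_ofNat]
    rw [← pow_eq_pow_mod i N2_pow_nine, ← pow_eq_pow_mod j diagElt_pow_three]
  · rintro ⟨i, j, rfl⟩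
    exact normalWord_mem_Gsub i j

set_option maxRecDepth 10000 in
theorem normalWord_pow_nine : ∀ i j, normalWord i j ^ 9 = 1 := by
  decide +kernel

set_option maxRecDepth 10000 in
theorem normalWord_fixes_basePoint : ∀ i j,
    vecMul basePoint (normalWord i j).1 = basePoint → i = 0 ∧ j = 0 := by
  decide +kernel

set_option maxRecDepth 10000 in
theorem exists_vecMul_basePoint_eq : ∀ v : Fin 6 → ZMod 2, v ≠ 0 → Qform v = 0 →
    ∃ i j, vecMul basePoint (normalWord i j).1 = v := by
  decide +kernel

theorem eq_one_of_fixes_basePoint {g : GL (Fin 6) (ZMod 2)} (hg : g ∈ Gsub)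
    (h : vecMul basePoint g.1 = basePoint) : g = 1 := by
  obtain ⟨i, j, rfl⟩ := mem_Gsub_iff.1 hg
  obtain ⟨rfl, rfl⟩ := normalWord_fixes_basePoint i j h
  simp [normalWord]

theorem vecMul_inv_of_vecMul_eq {g : GL (Fin 6) (ZMod 2)} {v w : Fin 6 → ZMod 2}
    (h : vecMul v g.1 = w) : vecMul w (g⁻¹).1 = v := by
  rw [← h, vecMul_vecMul, ← Units.val_mul, mul_inv_cancel, Units.val_one, vecMul_one]

set_option maxRecDepth 10000 in
theorem Qform_vecMul_N1 : ∀ v, Qform (vecMul v N1.1) = Qform v := by decide +kernel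

set_option maxRecDepth 10000 in
theorem Qform_vecMul_N2 : ∀ v, Qform (vecMul v N2.1) = Qform v := by decide +kernel

theorem Qform_vecMul_of_mem_Gsub {g : GL (Fin 6) (ZMod 2)} (hg : g ∈ Gsub)
    (v : Fin 6 → ZMod 2) : Qform (vecMul v g.1) = Qform v := by
  induction hg using Subgroup.closure_induction generalizing v with
  | mem x hx =>
    rcases hx with rfl | rfl
    · exact Qform_vecMul_N1 v
    · exact Qform_vecMul_N2 v
  | one => simp
  | mul x y _ _ hx hy => rw [Units.val_mul, ← vecMul_vecMul, hy, hx]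
  | inv x _ hx =>
    rw [← hx, vecMul_vecMul, ← Units.val_mul, inv_mul_cancel, Units.val_one, vecMul_one]

set_option maxRecDepth 10000 in
theorem card_singular : Nat.card {v : Fin 6 → ZMod 2 | v ≠ 0 ∧ Qform v = 0} = 27 := by
  rw [Nat.card_eq_fintype_card]
  change Fintype.card {v : Fin 6 → ZMod 2 // v ≠ 0 ∧ Qform v = 0} = 27
  decide +kernel

set_option maxRecDepth 10000 in
theorem basePoint_singular : basePoint ≠ 0 ∧ Qform basePoint = 0 := by decide

theorem card_Gsub : Nat.card Gsub = 27 := by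
  rw [← card_singular]
  refine Nat.card_eq_of_bijective (fun g => ⟨vecMul basePoint g.1.1, fun h => ?_, ?_⟩) ⟨?_, ?_⟩
  · have := vecMul_inv_of_vecMul_eq h
    rw [zero_vecMul] at this
    exact basePoint_singular.1 this.symm
  · rw [Qform_vecMul_of_mem_Gsub g.2, basePoint_singular.2]
  · rintro ⟨g, hg⟩ ⟨h, hh⟩ hgh
    have hgh : vecMul basePoint g.1 = vecMul basePoint h.1 := congrArg Subtype.val hgh
    have h1 : g * h⁻¹ = 1 := by
      refine eq_one_of_fixes_basePoint (Gsub.mul_mem hg (Gsub.inv_mem hh)) ?_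
      rw [Units.val_mul, ← vecMul_vecMul, hgh]
      exact vecMul_inv_of_vecMul_eq rfl
    exact Subtype.ext (mul_inv_eq_one.1 h1)
  · rintro ⟨v, hv, hQ⟩
    obtain ⟨i, j, h⟩ := exists_vecMul_basePoint_eq v hv hQ
    exact ⟨⟨_, normalWord_mem_Gsub i j⟩, Subtype.ext h⟩

set_option maxRecDepth 10000 in
theorem N2_pow_three_ne_one : N2 ^ 3 ≠ 1 := by decide

theorem exponent_Gsub : Monoid.exponent Gsub = 9 := by
  have hdvd : Monoid.exponent Gsub ∣ 3 ^ 2 := by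
    refine Monoid.exponent_dvd_of_forall_pow_eq_one ?_
    rintro ⟨g, hg⟩
    obtain ⟨i, j, rfl⟩ := mem_Gsub_iff.1 hg
    exact Subtype.ext (normalWord_pow_nine i j)
  obtain ⟨k, hk, he⟩ := (Nat.dvd_prime_pow Nat.prime_three).1 hdvd
  rcases hk.lt_or_eq with hk | rfl
  · have h3 : Monoid.exponent Gsub ∣ 3 := by
      rw [he]
      simpa using pow_dvd_pow 3 (Nat.lt_succ_iff.1 hk)
    have := Monoid.exponent_dvd_iff_forall_pow_eq_one.1 h3 ⟨N2, N2_mem_Gsub⟩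
    exact absurd (congrArg Subtype.val this) N2_pow_three_ne_one
  · exact he

set_option maxRecDepth 10000 in
theorem N1_mul_N2_ne : N1 * N2 ≠ N2 * N1 := by decide

theorem not_isMulCommutative_Gsub : ¬ IsMulCommutative Gsub := fun h =>
  N1_mul_N2_ne (congrArg Subtype.val
    (h.is_comm.comm ⟨N1, N1_mem_Gsub⟩ ⟨N2, N2_mem_Gsub⟩))

/-- `G` is extraspecial of order 27 and exponent 9, every element of `G` preserves `Q`,
and `G` acts freely and transitively on the 27 nonzero singular vectors of `Q`,
the points of `Q⁻(5,2)`. -/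
theorem Gsub_extraspecial_exponent_nine_regular :
    Nat.card Gsub = 27 ∧
    Monoid.exponent Gsub = 9 ∧
    Subgroup.map Gsub.subtype (Subgroup.center Gsub) = ⁅Gsub, Gsub⁆ ∧
    Subgroup.map Gsub.subtype (frattini Gsub) = ⁅Gsub, Gsub⁆ ∧
    Nat.card (Subgroup.center Gsub) = 3 ∧
    (∀ g ∈ Gsub, ∀ v : Fin 6 → ZMod 2,
      Qform (Matrix.vecMul v (g : Matrix (Fin 6) (Fin 6) (ZMod 2))) = Qform v) ∧
    Nat.card {v : Fin 6 → ZMod 2 | v ≠ 0 ∧ Qform v = 0} = 27 ∧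
    (∀ v : Fin 6 → ZMod 2, v ≠ 0 → Qform v = 0 →
      ∀ w : Fin 6 → ZMod 2, w ≠ 0 → Qform w = 0 →
        ∃ g ∈ Gsub, Matrix.vecMul v (g : Matrix (Fin 6) (Fin 6) (ZMod 2)) = w) ∧
    (∀ g ∈ Gsub,
      (∃ v : Fin 6 → ZMod 2, v ≠ 0 ∧ Qform v = 0 ∧
        Matrix.vecMul v (g : Matrix (Fin 6) (Fin 6) (ZMod 2)) = v) → g = 1) := by
  have hcard : Nat.card Gsub = 3 ^ 3 := card_Gsub
  have hnc := not_isMulCommutative_Gsub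
  have hcomm := Subgroup.commutator_eq_center_of_card_eq_prime_cube hcard hnc
  refine ⟨card_Gsub, exponent_Gsub, ?_, ?_,
    Subgroup.card_center_of_card_eq_prime_cube hcard hnc,
    fun g hg v => Qform_vecMul_of_mem_Gsub hg v, card_singular, ?_, ?_⟩
  · rw [← hcomm, Subgroup.map_subtype_commutator]
  · rw [Subgroup.frattini_eq_center_of_card_eq_prime_cube hcard hnc, ← hcomm,
      Subgroup.map_subtype_commutator]
  · intro v hv hQv w hw hQw
    obtain ⟨i, j, h⟩ := exists_vecMul_basePoint_eq v hv hQv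
    obtain ⟨k, l, h'⟩ := exists_vecMul_basePoint_eq w hw hQw
    refine ⟨(normalWord i j)⁻¹ * normalWord k l,
      Gsub.mul_mem (Gsub.inv_mem (normalWord_mem_Gsub i j)) (normalWord_mem_Gsub k l), ?_⟩
    rw [Units.val_mul, ← vecMul_vecMul, vecMul_inv_of_vecMul_eq h, h']
  · rintro g hg ⟨v, hv, hQv, hgv⟩
    obtain ⟨i, j, h⟩ := exists_vecMul_basePoint_eq v hv hQv
    have hm := normalWord_mem_Gsub i j
    have h1 : normalWord i j * g * (normalWord i j)⁻¹ = 1 := by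
      refine eq_one_of_fixes_basePoint (Gsub.mul_mem (Gsub.mul_mem hm hg) (Gsub.inv_mem hm)) ?_
      rw [Units.val_mul, Units.val_mul, ← vecMul_vecMul, ← vecMul_vecMul, h, hgv,
        vecMul_inv_of_vecMul_eq h]
    rwa [conj_eq_one_iff] at h1
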